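/- Let n ≥ 1, T > 0 and γ ∈ [0,1). Let v : ℝⁿ × (0,T) → ℝ be measurable and locally integrable on ℝⁿ × (0,T), with sup_{0<t<T} t^γ (ess sup_{x ∈ ℝⁿ} |v(x,t)|) < ∞. Assume that ∫₀^T ∫_{ℝⁿ} v(x,t) ( ∂ₜφ(x,t) + Δφ(x,t) ) dx dt = 0 for every smooth φ : ℝⁿ × ℝ → ℝ whose support is a compact subset of ℝⁿ × (−∞, T). Then v = 0 almost everywhere on ℝⁿ × (0,T). -/

import Mathlib

open MeasureTheory Set Metric Filter

noncomputable section

abbrev En (n : ℕ) := EuclideanSpace ℝ (Fin n)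

/-- the `i`-th standard basis vector of `ℝⁿ`. -/
def eb (n : ℕ) (i : Fin n) : En n := EuclideanSpace.single i 1

/-- the Laplacian `Δf`, computed as the sum of the second derivatives in the
coordinate directions. -/
def vlap {n : ℕ} {F : Type*} [NormedAddCommGroup F] [NormedSpace ℝ F]
    (f : En n → F) (x : En n) : F :=
  ∑ i, fderiv ℝ (fun y => fderiv ℝ f y (eb n i)) x (eb n i)

/-- the divergence `div v = Σⱼ ∂vʲ/∂xⱼ` of a vector field. -/
def vdiv {n : ℕ} (v : En n → En n) (x : En n) : ℝ :=
  ∑ i, fderiv ℝ v x (eb n i) i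

/-- the index of the last coordinate of `ℝⁿ`. -/
def lastIdx (n : ℕ) (hn : 2 ≤ n) : Fin n := ⟨n - 1, by omega⟩

/-- the last coordinate `xₙ` of a point of `ℝⁿ`. -/
def xlast (n : ℕ) (hn : 2 ≤ n) (x : En n) : ℝ := x (lastIdx n hn)

/-- the open upper half space `ℝⁿ₊ = {x : xₙ > 0}`. -/
def openHalf (n : ℕ) (hn : 2 ≤ n) : Set (En n) := {x : En n | 0 < xlast n hn x}

/-- the closed upper half space `{x : xₙ ≥ 0}`. -/
def closedHalf (n : ℕ) (hn : 2 ≤ n) : Set (En n) := {x : En n | 0 ≤ xlast n hn x}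

section InnerProductSpace

variable {E : Type*} [NormedAddCommGroup E] [InnerProductSpace ℝ E] [MeasurableSpace E]
  [BorelSpace E]

/-- A function whose bilateral Laplace transform exists and vanishes everywhere is zero. -/
theorem ae_eq_zero_of_integral_mul_exp_inner_eq_zero [SecondCountableTopology E] [CompleteSpace E]
    {μ : Measure E} {h : E → ℝ} (hm : Measurable h)
    (hi : ∀ ξ : E, Integrable (fun x => h x * Real.exp (inner ℝ ξ x)) μ)
    (hz : ∀ ξ : E, ∫ x, h x * Real.exp (inner ℝ ξ x) ∂μ = 0) : ∀ᵐ x ∂μ, h x = 0 := by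
  have hint : Integrable h μ := by simpa using hi 0
  let ν₁ := μ.withDensity fun x => ENNReal.ofReal (h x)
  let ν₂ := μ.withDensity fun x => ENNReal.ofReal (-h x)
  have hm₁ : Measurable fun x => ENNReal.ofReal (h x) := hm.ennreal_ofReal
  have hm₂ : Measurable fun x => ENNReal.ofReal (-h x) := hm.neg.ennreal_ofReal
  have fin₁ : IsFiniteMeasure ν₁ := isFiniteMeasure_withDensity_ofReal hint.2
  have fin₂ : IsFiniteMeasure ν₂ := isFiniteMeasure_withDensity_ofReal hint.neg.2
  have hmax (ξ x : E) : max (h x) 0 * Real.exp (inner ℝ ξ x) =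
      max (h x * Real.exp (inner ℝ ξ x)) 0 := by
    rw [max_mul_of_nonneg _ _ (Real.exp_pos _).le, zero_mul]
  have hmax' (ξ x : E) : max (-h x) 0 * Real.exp (inner ℝ ξ x) =
      max (-(h x * Real.exp (inner ℝ ξ x))) 0 := by
    rw [max_mul_of_nonneg _ _ (Real.exp_pos _).le, zero_mul, neg_mul]
  have hmgf (ξ : E) : ProbabilityTheory.mgf (fun x => inner ℝ ξ x) ν₁ =
      ProbabilityTheory.mgf (fun x => inner ℝ ξ x) ν₂ := by
    funext t
    simp only [ProbabilityTheory.mgf, ν₁, ν₂]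
    rw [integral_withDensity_eq_integral_toReal_smul hm₁ (by simp),
      integral_withDensity_eq_integral_toReal_smul hm₂ (by simp)]
    simp only [ENNReal.toReal_ofReal', smul_eq_mul, ← real_inner_smul_left, hmax, hmax']
    rw [← sub_eq_zero, ← integral_sub (hi _).pos_part (hi _).neg_part]
    simp only [max_zero_sub_max_neg_zero_eq_self, hz]
  have hset (ξ : E) : ProbabilityTheory.integrableExpSet (fun x => inner ℝ ξ x) ν₁ = univ := by
    refine eq_univ_of_forall fun t => ?_
    simp only [ProbabilityTheory.integrableExpSet, mem_ofPred_eq, ν₁]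
    rw [integrable_withDensity_iff_integrable_smul' hm₁ (by simp)]
    simp only [ENNReal.toReal_ofReal', smul_eq_mul, ← real_inner_smul_left, hmax]
    exact (hi _).pos_part
  have hzero : ν₁ = 0 ↔ ν₂ = 0 := by
    have := congrFun (hmgf 0) 0
    simp only [ProbabilityTheory.mgf_zero'] at this
    rw [← Measure.measure_univ_eq_zero, ← Measure.measure_univ_eq_zero, ← measureReal_eq_zero_iff,
      ← measureReal_eq_zero_iff, this]
  have hν : ν₁ = ν₂ := by
    refine Measure.ext_of_charFun (funext fun ξ => ?_)
    have := ProbabilityTheory.eqOn_complexMGF_of_mgf' (hmgf ξ) hzero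
      (show Complex.I ∈ _ by simp [hset])
    simpa only [ProbabilityTheory.complexMGF, charFun_apply, real_inner_comm, mul_comm] using this
  have hae := (withDensity_eq_iff hm₁.aemeasurable hm₂.aemeasurable hint.lintegral_lt_top.ne).1 hν
  filter_upwards [hae] with x hx
  rcases le_total (h x) 0 with h0 | h0
  · rw [ENNReal.ofReal_of_nonpos h0, eq_comm, ENNReal.ofReal_eq_zero] at hx
    linarith
  · rw [ENNReal.ofReal_of_nonpos (p := -h x) (by linarith), ENNReal.ofReal_eq_zero] at hx
    linarith

variable [FiniteDimensional ℝ E]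

theorem integrable_exp_neg_mul_norm_sq_add_inner {b : ℝ} (hb : 0 < b) (ξ : E) :
    Integrable fun x : E => Real.exp (-b * ‖x‖ ^ 2 + inner ℝ ξ x) := by
  have := (GaussianFourier.integrable_cexp_neg_mul_sq_norm_add (V := E) (b := b) (by simpa) 1 ξ).re
  refine this.congr (ae_of_all _ fun x => ?_)
  simp only [RCLike.re_to_complex]
  rw [← Complex.exp_ofReal_re]
  push_cast
  simp

theorem integrable_exp_neg_mul_norm_sub_sq {b : ℝ} (hb : 0 < b) (a : E) :
    Integrable fun x : E => Real.exp (-b * ‖x - a‖ ^ 2) := by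
  have := (integrable_exp_neg_mul_norm_sq_add_inner hb (0 : E)).comp_sub_right a
  simpa using this

theorem integrable_one_add_norm_mul_exp_neg_mul_norm_sub_sq {b : ℝ} (hb : 0 < b) (a : E) :
    Integrable fun x : E => (1 + ‖x - a‖) * Real.exp (-b * ‖x - a‖ ^ 2) := by
  refine ((integrable_exp_neg_mul_norm_sub_sq (half_pos hb) a).const_mul (2 + 2 / b)).mono'
    (by fun_prop) (ae_of_all _ fun x => ?_)
  set y := ‖x - a‖
  have hy : 0 ≤ y := norm_nonneg _
  rw [Real.norm_of_nonneg (by positivity)]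
  have h1 : Real.exp (-b * y ^ 2) = Real.exp (-(b / 2) * y ^ 2) * Real.exp (-(b / 2) * y ^ 2) := by
    rw [← Real.exp_add]; ring_nf
  have h2 : (1 + y) ≤ (2 + 2 / b) * Real.exp (b / 2 * y ^ 2) := by
    have h3 := Real.add_one_le_exp (b / 2 * y ^ 2)
    have h4 : (2 + 2 / b) * (b / 2 * y ^ 2 + 1) = b * y ^ 2 + y ^ 2 + 2 + 2 / b := by
      field_simp; ring
    have h5 : 1 + y ≤ (2 + 2 / b) * (b / 2 * y ^ 2 + 1) := by
      rw [h4]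
      have : 0 ≤ b * y ^ 2 + 2 / b := by positivity
      nlinarith [sq_nonneg (y - 1 / 2)]
    exact h5.trans (by gcongr)
  rw [h1, ← mul_assoc]
  gcongr
  calc (1 + y) * Real.exp (-(b / 2) * y ^ 2)
      ≤ (2 + 2 / b) * Real.exp (b / 2 * y ^ 2) * Real.exp (-(b / 2) * y ^ 2) := by gcongr
    _ = 2 + 2 / b := by rw [mul_assoc, ← Real.exp_add]; simp

/-- The Gaussian smoothing of an essentially bounded function is continuous. -/
theorem continuous_integral_mul_exp_neg_mul_norm_sub_sq {f : E → ℝ} {B b : ℝ}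
    (hf : Measurable f) (hB : ∀ᵐ x, |f x| ≤ B) (hb : 0 < b) :
    Continuous fun a : E => ∫ x, f x * Real.exp (-b * ‖x - a‖ ^ 2) := by
  refine continuous_iff_continuousAt.2 fun a₀ => ?_
  set R := ‖a₀‖ + 1
  have hI := integrable_exp_neg_mul_norm_sub_sq (half_pos hb) (0 : E)
  refine continuousAt_of_dominated
    (bound := fun x => B * (Real.exp (b * R ^ 2) * Real.exp (-(b / 2) * ‖x - 0‖ ^ 2)))
    (Eventually.of_forall fun a => by fun_prop) ?_ ((hI.const_mul _).const_mul _)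
    (ae_of_all _ fun x => by fun_prop)
  filter_upwards [Metric.ball_mem_nhds a₀ one_pos] with a ha
  filter_upwards [hB] with x hx
  have haR : ‖a‖ ≤ R := by
    have := norm_sub_norm_le a a₀
    rw [mem_ball, dist_eq_norm] at ha
    linarith
  rw [norm_mul, Real.norm_eq_abs, Real.norm_of_nonneg (Real.exp_pos _).le, ← Real.exp_add]
  have h1 : ‖x‖ ≤ ‖x - a‖ + ‖a‖ := by simpa using norm_add_le (x - a) a
  have h2 : ‖x‖ ^ 2 ≤ 2 * ‖x - a‖ ^ 2 + 2 * R ^ 2 := by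
    nlinarith [norm_nonneg x, norm_nonneg a, norm_nonneg (x - a), sq_nonneg (‖x - a‖ - R)]
  refine mul_le_mul hx (Real.exp_le_exp.2 ?_) (Real.exp_pos _).le ((abs_nonneg _).trans hx)
  rw [sub_zero]
  nlinarith

/-- Gaussian smoothing at a fixed scale is injective on essentially bounded functions. -/
theorem ae_eq_zero_of_integral_mul_exp_neg_mul_norm_sub_sq_eq_zero {f : E → ℝ} {B b : ℝ}
    (hf : Measurable f) (hB : ∀ᵐ x, |f x| ≤ B) (hb : 0 < b) {D : Set E} (hD : Dense D)
    (hz : ∀ a ∈ D, ∫ x, f x * Real.exp (-b * ‖x - a‖ ^ 2) = 0) : ∀ᵐ x, f x = 0 := by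
  have hz' (a : E) : ∫ x, f x * Real.exp (-b * ‖x - a‖ ^ 2) = 0 := congrFun
    ((continuous_integral_mul_exp_neg_mul_norm_sub_sq hf hB hb).ext_on hD continuous_const hz) a
  have key := ae_eq_zero_of_integral_mul_exp_inner_eq_zero (μ := volume)
    (h := fun x => f x * Real.exp (-b * ‖x‖ ^ 2)) (by fun_prop) (fun ξ => ?_) fun ξ => ?_
  · filter_upwards [key] with x hx
    simpa [Real.exp_ne_zero] using hx
  · refine ((integrable_exp_neg_mul_norm_sq_add_inner hb ξ).bdd_mul (c := B)
      hf.aestronglyMeasurable hB).congr (ae_of_all _ fun x => ?_)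
    simp only [Real.exp_add, mul_assoc]
  · have hexp (x : E) : f x * Real.exp (-b * ‖x‖ ^ 2) * Real.exp (inner ℝ ξ x) =
        Real.exp (b * ‖(2 * b)⁻¹ • ξ‖ ^ 2) *
          (f x * Real.exp (-b * ‖x - (2 * b)⁻¹ • ξ‖ ^ 2)) := by
      rw [mul_assoc, mul_left_comm (Real.exp (b * _)), ← Real.exp_add, ← Real.exp_add, norm_sub_sq_real,
        real_inner_smul_right, real_inner_comm]
      congr 2
      field_simp
      ring
    simp only [hexp, integral_const_mul, hz', mul_zero]

end InnerProductSpace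

theorem inner_eb_left {n : ℕ} (i : Fin n) (x : En n) : inner ℝ (eb n i) x = x i := by
  simp [eb, EuclideanSpace.inner_single_left]

theorem inner_eb_right {n : ℕ} (i : Fin n) (x : En n) : inner ℝ x (eb n i) = x i := by
  rw [real_inner_comm, inner_eb_left]

theorem eb_apply_self {n : ℕ} (i : Fin n) : eb n i i = 1 := by
  simp [eb]

theorem vlap_const_mul {n : ℕ} (c : ℝ) (f : En n → ℝ) (x : En n) :
    vlap (fun y => c * f y) x = c * vlap f x := by
  have h (g : En n → ℝ) (y : En n) : fderiv ℝ (fun z => c * g z) y = c • fderiv ℝ g y :=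
    congrFun (fderiv_const_smul_field c) y
  simp only [vlap, Finset.mul_sum, h, smul_apply, smul_eq_mul]

theorem vlap_mul {n : ℕ} {f g : En n → ℝ} (hf : ContDiff ℝ 2 f) (hg : ContDiff ℝ 2 g)
    (x : En n) :
    vlap (fun y => f y * g y) x = vlap f x * g x +
      2 * ∑ i, fderiv ℝ f x (eb n i) * fderiv ℝ g x (eb n i) + f x * vlap g x := by
  have hf1 : Differentiable ℝ f := hf.differentiable (by norm_num)
  have hg1 : Differentiable ℝ g := hg.differentiable (by norm_num)
  have hd {k : En n → ℝ} (hk : ContDiff ℝ 2 k) (w : En n) :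
      Differentiable ℝ fun y => fderiv ℝ k y w :=
    ((hk.fderiv_right (m := 1) (by norm_num)).clm_apply contDiff_const).differentiable
      (by norm_num)
  simp only [vlap, Finset.mul_sum, Finset.sum_mul, ← Finset.sum_add_distrib]
  refine Finset.sum_congr rfl fun i _ => ?_
  have h1 : (fun y => fderiv ℝ (fun y => f y * g y) y (eb n i)) =
      fun y => f y * fderiv ℝ g y (eb n i) + g y * fderiv ℝ f y (eb n i) := by
    funext y
    rw [fderiv_fun_mul (hf1 y) (hg1 y)]
    rfl
  rw [h1, fderiv_fun_add ((hf1 x).fun_mul (hd hg _ x)) ((hg1 x).fun_mul (hd hf _ x)),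
    fderiv_fun_mul (hf1 x) (hd hg _ x), fderiv_fun_mul (hg1 x) (hd hf _ x)]
  simp only [add_apply, smul_apply, smul_eq_mul]
  ring

theorem vlap_comp_smul {n : ℕ} (c : ℝ) (f : En n → ℝ) (x : En n) :
    vlap (fun y => f (c • y)) x = c ^ 2 * vlap f (c • x) := by
  simp only [vlap, Finset.mul_sum]
  refine Finset.sum_congr rfl fun i _ => ?_
  have h1 : (fun y => fderiv ℝ (fun y => f (c • y)) y (eb n i)) =
      fun y => c * (fun z => fderiv ℝ f z (eb n i)) (c • y) := by
    funext y
    rw [fderiv_comp_smul]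
    rfl
  have h2 (g : En n → ℝ) : fderiv ℝ (fun y => c * g (c • y)) x = c • c • fderiv ℝ g (c • x) := by
    rw [← fderiv_comp_smul]
    exact congrFun (fderiv_const_smul_field c) x
  rw [h1, h2 fun z => fderiv ℝ f z (eb n i)]
  simp only [smul_apply, smul_eq_mul]
  ring

theorem ContDiff.continuous_vlap {n : ℕ} {f : En n → ℝ} (hf : ContDiff ℝ 2 f) :
    Continuous (vlap f) := by
  unfold vlap
  refine continuous_finsetSum _ fun i _ => ?_
  exact ((((hf.fderiv_right (m := 1) (by norm_num)).clm_apply contDiff_const).fderiv_right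
    (m := 0) (by norm_num)).clm_apply contDiff_const).continuous

theorem HasCompactSupport.vlap {n : ℕ} {f : En n → ℝ} (hf : HasCompactSupport f) :
    HasCompactSupport (vlap f) := by
  refine hf.mono' fun x hx => ?_
  by_contra hx'
  refine hx (Finset.sum_eq_zero fun i _ => ?_)
  have h1 : (fun y => fderiv ℝ f y (eb n i)) =ᶠ[nhds x] fun _ => 0 := by
    filter_upwards [(notMem_tsupport_iff_eventuallyEq.1 hx').eventuallyEq_nhds] with y hy
    rw [hy.fderiv_eq]
    simp
  rw [h1.fderiv_eq]
  simp

/-- The unnormalised backward heat kernel with pole `(a, s)`. -/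
def backwardHeatKernel {n : ℕ} (s : ℝ) (a x : En n) (t : ℝ) : ℝ :=
  Real.exp (-(n / 2) * Real.log (s - t) - (4 * (s - t))⁻¹ * ‖x - a‖ ^ 2)

section backwardHeatKernel

variable {n : ℕ} {s t : ℝ} (a : En n)

theorem contDiff_backwardHeatKernel : ContDiff ℝ ⊤ fun x => backwardHeatKernel s a x t := by
  unfold backwardHeatKernel
  have : ContDiff ℝ ⊤ fun x : En n => ‖x - a‖ ^ 2 := (contDiff_id.sub contDiff_const).norm_sq ℝ
  exact (contDiff_const.sub (contDiff_const.mul this)).exp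

theorem contDiffAt_backwardHeatKernel (hst : t < s) (x : En n) :
    ContDiffAt ℝ ⊤ (fun p : En n × ℝ => backwardHeatKernel s a p.1 p.2) (x, t) := by
  unfold backwardHeatKernel
  have h0 : s - t ≠ 0 := (sub_pos.2 hst).ne'
  have h1 : ContDiffAt ℝ ⊤ (fun p : En n × ℝ => s - p.2) (x, t) :=
    contDiffAt_const.sub contDiffAt_snd
  have h2 : ContDiffAt ℝ ⊤ (fun p : En n × ℝ => ‖p.1 - a‖ ^ 2) (x, t) :=
    (contDiffAt_fst.sub contDiffAt_const).norm_sq ℝ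
  exact ((contDiffAt_const.mul (h1.log h0)).sub
    (((contDiffAt_const.mul h1).inv (by simpa using h0)).mul h2)).exp

theorem measurable_backwardHeatKernel :
    Measurable fun p : En n × ℝ => backwardHeatKernel s a p.1 p.2 := by
  unfold backwardHeatKernel
  fun_prop

theorem fderiv_backwardHeatKernel (x w : En n) :
    fderiv ℝ (fun y => backwardHeatKernel s a y t) x w =
      -(2 * (s - t))⁻¹ * inner ℝ (x - a) w * backwardHeatKernel s a x t := by
  unfold backwardHeatKernel
  have h := ((((hasFDerivAt_id x).sub_const a).norm_sq.const_mul
    (4 * (s - t))⁻¹).const_sub (-(n / 2) * Real.log (s - t))).exp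
  simp only [id_eq] at h
  rw [h.fderiv]
  simp [inner_sub_left]
  ring

theorem vlap_backwardHeatKernel (x : En n) :
    vlap (fun y => backwardHeatKernel s a y t) x =
      ((2 * (s - t))⁻¹ ^ 2 * ‖x - a‖ ^ 2 - n * (2 * (s - t))⁻¹) * backwardHeatKernel s a x t := by
  have h (i : Fin n) : fderiv ℝ (fun y => fderiv ℝ (fun y => backwardHeatKernel s a y t) y
      (eb n i)) x (eb n i) =
      ((2 * (s - t))⁻¹ ^ 2 * (x - a) i ^ 2 - (2 * (s - t))⁻¹) * backwardHeatKernel s a x t := by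
    have hK : DifferentiableAt ℝ (fun y => backwardHeatKernel s a y t) x :=
      (contDiff_backwardHeatKernel a).differentiable (by simp) x
    have hl : HasFDerivAt (fun y : En n => -(2 * (s - t))⁻¹ * inner ℝ (eb n i) (y - a))
        (-(2 * (s - t))⁻¹ • innerSL ℝ (eb n i)) x :=
      (((innerSL ℝ (eb n i)).hasFDerivAt.comp x
        ((hasFDerivAt_id x).sub_const a)).const_mul _)
    simp only [fderiv_backwardHeatKernel, real_inner_comm (eb n i)]
    rw [fderiv_fun_mul hl.differentiableAt hK, hl.fderiv]
    simp only [add_apply, smul_apply, smul_eq_mul,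
      fderiv_backwardHeatKernel, innerSL_apply_apply]
    simp only [inner_eb_left, real_inner_comm (eb n i), eb_apply_self]
    ring
  simp only [vlap, h, ← Finset.sum_mul, Finset.sum_sub_distrib, ← Finset.mul_sum,
    EuclideanSpace.real_norm_sq_eq]
  simp

theorem hasDerivAt_backwardHeatKernel (hst : t < s) (x : En n) :
    HasDerivAt (fun τ => backwardHeatKernel s a x τ)
      (-vlap (fun y => backwardHeatKernel s a y t) x) t := by
  rw [vlap_backwardHeatKernel a]
  unfold backwardHeatKernel
  have h0 : s - t ≠ 0 := (sub_pos.2 hst).ne'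
  have h1 : HasDerivAt (fun τ => s - τ) (-1) t := (hasDerivAt_id t).const_sub s
  have h := (((h1.log h0).const_mul (-(n / 2 : ℝ))).sub
    (((h1.const_mul 4).inv (by simpa using h0)).mul_const (‖x - a‖ ^ 2))).exp
  refine h.congr_deriv ?_
  simp only [Pi.inv_apply, Pi.sub_apply]
  field_simp
  ring

/-- The backward heat operator applied to a product of cutoffs and the backward heat kernel. -/
theorem backward_heat_operator_cutoff_mul (hst : t < s) {χ : En n → ℝ} (hχ : ContDiff ℝ 2 χ)
    {η : ℝ → ℝ} (hη : DifferentiableAt ℝ η t) (x : En n) :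
    deriv (fun τ => η τ * (χ x * backwardHeatKernel s a x τ)) t +
      vlap (fun y => η t * (χ y * backwardHeatKernel s a y t)) x =
    backwardHeatKernel s a x t *
      (deriv η t * χ x + η t * (vlap χ x - (s - t)⁻¹ * fderiv ℝ χ x (x - a))) := by
  have hK : ContDiff ℝ 2 fun y => backwardHeatKernel s a y t :=
    (contDiff_backwardHeatKernel a).of_le le_top
  have hgrad : ∑ i, fderiv ℝ χ x (eb n i) *
      fderiv ℝ (fun y => backwardHeatKernel s a y t) x (eb n i) =
      -(2 * (s - t))⁻¹ * fderiv ℝ χ x (x - a) * backwardHeatKernel s a x t := by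
    have hrepr : ∑ i, (x - a) i • eb n i = x - a := by
      simpa [eb] using (EuclideanSpace.basisFun (Fin n) ℝ).sum_repr (x - a)
    conv_rhs => rw [← hrepr]
    rw [map_sum, Finset.mul_sum, Finset.sum_mul]
    refine Finset.sum_congr rfl fun i _ => ?_
    rw [fderiv_backwardHeatKernel, map_smul]
    rw [inner_eb_right, smul_eq_mul]
    ring
  rw [vlap_const_mul, vlap_mul hχ hK, hgrad,
    (hη.hasDerivAt.fun_mul ((hasDerivAt_backwardHeatKernel a hst x).const_mul (χ x))).deriv]
  have h0 : s - t ≠ 0 := (sub_pos.2 hst).ne'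
  field_simp
  ring

end backwardHeatKernel

theorem exists_contDiff_hasCompactSupport_deriv_eq {T : ℝ} (hT : 0 < T) {ζ : ℝ → ℝ}
    (hζ : ContDiff ℝ (⊤ : ℕ∞) ζ) (hc : HasCompactSupport ζ) (hs : tsupport ζ ⊆ Ioo 0 T) :
    ∃ η : ℝ → ℝ, ContDiff ℝ (⊤ : ℕ∞) η ∧ HasCompactSupport η ∧ tsupport η ⊆ Iio T ∧
      ∀ t ∈ Ioo 0 T, deriv η t = ζ t := by
  obtain ⟨T', hT', hζT'⟩ : ∃ T' < T, tsupport ζ ⊆ Iic T' := by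
    rcases (tsupport ζ).eq_empty_or_nonempty with h | h
    · exact ⟨0, hT, by simp [h]⟩
    · obtain ⟨m, hm, hmax⟩ := hc.isCompact.exists_isGreatest h
      exact ⟨m, (hs hm).2, hmax⟩
  let P : ℝ → ℝ := fun t => ∫ τ in T..t, ζ τ
  have hP (t : ℝ) : HasDerivAt P (ζ t) t :=
    intervalIntegral.integral_hasDerivAt_right (hζ.continuous.intervalIntegrable _ _)
      (hζ.continuous.stronglyMeasurableAtFilter _ _) hζ.continuous.continuousAt
  have hPs : ContDiff ℝ (⊤ : ℕ∞) P := by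
    refine contDiff_infty_iff_deriv.2 ⟨fun t => (hP t).differentiableAt, ?_⟩
    rwa [show deriv P = ζ from funext fun t => (hP t).deriv]
  have hP0 : tsupport P ⊆ Iic T' := by
    refine closure_minimal (fun t ht => ?_) isClosed_Iic
    by_contra hlt
    rw [mem_Iic, not_le] at hlt
    refine ht (intervalIntegral.integral_zero_ae (ae_of_all _ fun τ hτ => ?_))
    have : T' < τ := (lt_min hT' hlt).trans hτ.1
    exact image_eq_zero_of_notMem_tsupport fun h => this.not_ge (hζT' h)
  let ξ : ContDiffBump (0 : ℝ) := ⟨T, T + 1, hT, by linarith⟩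
  refine ⟨fun t => ξ t * P t, ξ.contDiff.mul hPs, ξ.hasCompactSupport.mul_right,
    (tsupport_mul_subset_right.trans hP0).trans fun t ht => lt_of_le_of_lt ht hT',
    fun t ht => ?_⟩
  have hξ : (fun t => ξ t * P t) =ᶠ[nhds t] P := by
    filter_upwards [ξ.eventuallyEq_one_of_mem_ball (x := t)
      (by simp [ξ, abs_of_pos ht.1, ht.2])] with τ hτ
    simp [hτ]
  rw [hξ.deriv_eq, (hP t).deriv]

theorem integrableOn_Ioo_rpow_neg {T γ : ℝ} (hT : 0 < T) (hγ : γ < 1) :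
    IntegrableOn (fun t : ℝ => t ^ (-γ)) (Ioo 0 T) :=
  (intervalIntegrable_iff_integrableOn_Ioo_of_le hT.le).1
    (intervalIntegral.intervalIntegrable_rpow' (by linarith))

theorem abs_backwardHeatKernel_le {n : ℕ} {T t : ℝ} (ht : t ∈ Ioo 0 T) (a x : En n) :
    |backwardHeatKernel (T + 1) a x t| ≤ Real.exp (-(4 * (T + 1))⁻¹ * ‖x - a‖ ^ 2) := by
  have h1 : 1 ≤ T + 1 - t := by linarith [ht.2]
  unfold backwardHeatKernel
  rw [abs_of_pos (Real.exp_pos _), Real.exp_le_exp]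
  have h2 : 0 ≤ (n / 2 : ℝ) * Real.log (T + 1 - t) :=
    mul_nonneg (by positivity) (Real.log_nonneg h1)
  have h3 : (4 * (T + 1))⁻¹ ≤ (4 * (T + 1 - t))⁻¹ := by
    gcongr
    linarith [ht.1]
  have h4 := mul_le_mul_of_nonneg_right h3 (sq_nonneg ‖x - a‖)
  linarith

section WeakSolution

variable {n : ℕ} {T γ C : ℝ} {v : En n → ℝ → ℝ}

theorem ae_abs_le_mul_rpow_neg
    (hbd : ∀ t ∈ Ioo (0 : ℝ) T, ∀ᵐ x ∂(volume : Measure (En n)), t ^ γ * |v x t| ≤ C) {t : ℝ}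
    (ht : t ∈ Ioo 0 T) : ∀ᵐ x, |v x t| ≤ C * t ^ (-γ) := by
  filter_upwards [hbd t ht] with x hx
  have hpos := Real.rpow_pos_of_pos ht.1 γ
  rw [Real.rpow_neg ht.1.le, ← div_eq_mul_inv, le_div_iff₀ hpos, mul_comm]
  exact hx

theorem integrableOn_integral_mul_backwardHeatKernel (hT : 0 < T) (hγ : γ < 1)
    (hmeas : Measurable fun p : En n × ℝ => v p.1 p.2)
    (hbd : ∀ t ∈ Ioo (0 : ℝ) T, ∀ᵐ x ∂(volume : Measure (En n)), t ^ γ * |v x t| ≤ C)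
    (a : En n) :
    IntegrableOn (fun t => ∫ x, v x t * backwardHeatKernel (T + 1) a x t) (Ioo 0 T) := by
  have hb : 0 < (4 * (T + 1))⁻¹ := by positivity
  have hG := integrable_exp_neg_mul_norm_sub_sq hb a
  refine (((integrableOn_Ioo_rpow_neg hT hγ).const_mul C).mul_const
    (∫ x : En n, Real.exp (-(4 * (T + 1))⁻¹ * ‖x - a‖ ^ 2))).mono' ?_ ?_
  · exact (hmeas.mul (measurable_backwardHeatKernel a)).stronglyMeasurable.integral_prod_left'
      |>.aestronglyMeasurable
  · filter_upwards [ae_restrict_mem measurableSet_Ioo] with t ht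
    rw [← integral_const_mul]
    refine norm_integral_le_of_norm_le (hG.const_mul _) ?_
    filter_upwards [ae_abs_le_mul_rpow_neg hbd ht] with x hx
    rw [norm_mul]
    exact mul_le_mul hx (abs_backwardHeatKernel_le ht a x) (norm_nonneg _)
      ((abs_nonneg _).trans hx)

theorem setIntegral_deriv_mul_integral_mul_backwardHeatKernel_eq_zero (hT : 0 < T) (hγ : γ < 1)
    (hmeas : Measurable fun p : En n × ℝ => v p.1 p.2)
    (hbd : ∀ t ∈ Ioo (0 : ℝ) T, ∀ᵐ x ∂(volume : Measure (En n)), t ^ γ * |v x t| ≤ C)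
    (hweak : ∀ φ : En n × ℝ → ℝ, ContDiff ℝ (⊤ : ℕ∞) φ → HasCompactSupport φ →
        tsupport φ ⊆ (univ : Set (En n)) ×ˢ Iio T →
        ∫ t in Ioo (0 : ℝ) T, ∫ x : En n,
          v x t * (deriv (fun s => φ (x, s)) t + vlap (fun y => φ (y, t)) x) = 0)
    (a : En n) {η : ℝ → ℝ} (hη : ContDiff ℝ (⊤ : ℕ∞) η) (hηc : HasCompactSupport η)
    (hηs : tsupport η ⊆ Iio T) :
    ∫ t in Ioo 0 T, deriv η t * ∫ x, v x t * backwardHeatKernel (T + 1) a x t = 0 := by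
  let χ : ContDiffBump (0 : En n) := default
  have hχ {m : ℕ∞} : ContDiff ℝ m χ := χ.contDiff
  have hχL : Continuous (vlap χ) := ContDiff.continuous_vlap (hχ (m := 2))
  have hχD : Continuous (fderiv ℝ χ) := (hχ (m := 1)).continuous_fderiv (by simp)
  have hη' : Continuous (deriv η) := hη.continuous_deriv (by simp)
  have hηd : Differentiable ℝ η := hη.differentiable (by simp)
  obtain ⟨M₀, hM₀⟩ := χ.hasCompactSupport.exists_bound_of_continuous χ.continuous
  obtain ⟨M₁, hM₁⟩ := (χ.hasCompactSupport.fderiv ℝ).exists_bound_of_continuous hχD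
  obtain ⟨M₂, hM₂⟩ := χ.hasCompactSupport.vlap.exists_bound_of_continuous hχL
  obtain ⟨N₀, hN₀⟩ := hηc.exists_bound_of_continuous hη.continuous
  obtain ⟨N₁, hN₁⟩ := hηc.deriv.exists_bound_of_continuous hη'
  have hM₀' := (norm_nonneg _).trans (hM₀ 0)
  have hM₁' := (norm_nonneg _).trans (hM₁ 0)
  have hM₂' := (norm_nonneg _).trans (hM₂ 0)
  have hN₀' := (norm_nonneg _).trans (hN₀ 0)
  have hN₁' := (norm_nonneg _).trans (hN₁ 0)
  let c : ℕ → ℝ := fun k => 1 / ((k : ℝ) + 1)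
  have hc0 (k) : 0 < c k := Nat.one_div_pos_of_nat
  have hc1 (k) : c k ≤ 1 := by
    simp only [c]
    rw [div_le_one (by positivity)]
    linarith [k.cast_nonneg (α := ℝ)]
  have hclim : Tendsto c atTop (nhds 0) := tendsto_one_div_add_atTop_nhds_zero_nat
  let w : ℕ → ℝ → En n → ℝ := fun k t x =>
    deriv η t * χ (c k • x) + η t * (c k ^ 2 * vlap χ (c k • x) -
      (T + 1 - t)⁻¹ * (c k * fderiv ℝ χ (c k • x) (x - a)))
  let G : En n → ℝ := fun x => (1 + ‖x - a‖) * Real.exp (-(4 * (T + 1))⁻¹ * ‖x - a‖ ^ 2)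
  have hG : Integrable G :=
    integrable_one_add_norm_mul_exp_neg_mul_norm_sub_sq (by positivity) a
  set M := N₁ * M₀ + N₀ * (M₂ + M₁)
  have hwM (k : ℕ) {t : ℝ} (ht : t ∈ Ioo 0 T) (x : En n) :
      ‖w k t x‖ ≤ M * (1 + ‖x - a‖) := by
    have h1 : ‖deriv η t * χ (c k • x)‖ ≤ N₁ * M₀ := by
      rw [norm_mul]
      gcongr
      exacts [hN₁ t, hM₀ _]
    have h2 : ‖c k ^ 2 * vlap χ (c k • x)‖ ≤ M₂ := by
      rw [norm_mul, Real.norm_of_nonneg (sq_nonneg _), ← one_mul M₂]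
      gcongr
      exacts [pow_le_one₀ (hc0 k).le (hc1 k), hM₂ _]
    have h3 : ‖(T + 1 - t)⁻¹ * (c k * fderiv ℝ χ (c k • x) (x - a))‖ ≤ M₁ * ‖x - a‖ := by
      have hr : 1 ≤ T + 1 - t := by linarith [ht.2]
      rw [norm_mul, norm_mul, Real.norm_of_nonneg (by positivity),
        Real.norm_of_nonneg (hc0 k).le, ← mul_assoc, ← one_mul (M₁ * _)]
      gcongr
      · exact mul_le_one₀ (inv_le_one_of_one_le₀ hr) (hc0 k).le (hc1 k)
      · exact (ContinuousLinearMap.le_opNorm _ _).trans (by gcongr; exact hM₁ _)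
    have h4 := (norm_sub_le _ _).trans (add_le_add h2 h3)
    have h5 : ‖w k t x‖ ≤ N₁ * M₀ + N₀ * (M₂ + M₁ * ‖x - a‖) := by
      refine (norm_add_le _ _).trans (add_le_add h1 ?_)
      rw [norm_mul]
      gcongr
      exact hN₀ t
    refine h5.trans ?_
    have hy := norm_nonneg (x - a)
    have : 0 ≤ N₁ * M₀ * ‖x - a‖ + N₀ * M₁ + N₀ * M₂ * ‖x - a‖ := by positivity
    simp only [M]
    linarith
  have hbound (k : ℕ) {t : ℝ} (ht : t ∈ Ioo 0 T) :
      ∀ᵐ x, ‖v x t * (backwardHeatKernel (T + 1) a x t * w k t x)‖ ≤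
        C * t ^ (-γ) * (M * G x) := by
    filter_upwards [ae_abs_le_mul_rpow_neg hbd ht] with x hx
    rw [norm_mul, norm_mul]
    have h1 : ‖backwardHeatKernel (T + 1) a x t‖ * ‖w k t x‖ ≤ M * G x := by
      rw [mul_comm, show M * G x = M * (1 + ‖x - a‖) * Real.exp (-(4 * (T + 1))⁻¹ * ‖x - a‖ ^ 2)
        from (mul_assoc _ _ _).symm]
      exact mul_le_mul (hwM k ht x) (abs_backwardHeatKernel_le ht a x) (norm_nonneg _)
        ((norm_nonneg _).trans (hwM k ht x))
    exact mul_le_mul hx h1 (by positivity) ((abs_nonneg _).trans hx)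
  have hwmeas (k : ℕ) : Measurable fun p : En n × ℝ =>
      v p.1 p.2 * (backwardHeatKernel (T + 1) a p.1 p.2 * w k p.2 p.1) := by
    have hDm : Measurable fun p : En n × ℝ => fderiv ℝ χ (c k • p.1) (p.1 - a) :=
      ((hχD.comp (continuous_fst.const_smul (c k))).clm_apply
        (continuous_fst.sub continuous_const)).measurable
    refine hmeas.mul ((measurable_backwardHeatKernel a).mul ?_)
    have hχm := χ.continuous.measurable
    have hLm := hχL.measurable
    have hηm := hη.continuous.measurable
    have hη'm := hη'.measurable
    simp only [w]
    fun_prop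
  have hzero (k : ℕ) :
      ∫ t in Ioo 0 T, ∫ x, v x t * (backwardHeatKernel (T + 1) a x t * w k t x) = 0 := by
    let φ : En n × ℝ → ℝ := fun p =>
      η p.2 * (χ (c k • p.1) * backwardHeatKernel (T + 1) a p.1 p.2)
    have hχk : ContDiff ℝ (⊤ : ℕ∞) fun x : En n => χ (c k • x) := hχ.comp (contDiff_const_smul _)
    have hχkc : HasCompactSupport fun x : En n => χ (c k • x) :=
      χ.hasCompactSupport.comp_smul (hc0 k).ne'
    have hsub : tsupport φ ⊆ tsupport (fun x : En n => χ (c k • x)) ×ˢ tsupport η := by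
      refine closure_minimal (fun p hp => ?_) ((isClosed_tsupport _).prod (isClosed_tsupport _))
      exact ⟨subset_tsupport _ (left_ne_zero_of_mul (right_ne_zero_of_mul hp)),
        subset_tsupport _ (left_ne_zero_of_mul hp)⟩
    have hφ : ContDiff ℝ (⊤ : ℕ∞) φ := by
      refine contDiff_iff_contDiffAt.2 fun p => ?_
      by_cases hp : p.2 < T + 1
      · exact (hη.contDiffAt.comp p contDiffAt_snd).mul ((hχk.contDiffAt.comp p contDiffAt_fst).mul
          ((contDiffAt_backwardHeatKernel a hp p.1).of_le le_top))
      · have hp' : p ∉ tsupport φ := fun h => by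
          have : p.2 < T := hηs (hsub h).2
          linarith
        exact (contDiffAt_const (c := (0 : ℝ))).congr_of_eventuallyEq
          (notMem_tsupport_iff_eventuallyEq.1 hp')
    refine Eq.trans ?_ (hweak φ hφ ((hχkc.isCompact.prod hηc.isCompact).of_isClosed_subset
      (isClosed_tsupport _) hsub) fun p hp => ⟨mem_univ _, hηs (hsub hp).2⟩)
    refine setIntegral_congr_fun measurableSet_Ioo fun t ht => ?_
    refine integral_congr_ae (ae_of_all _ fun x => ?_)
    simp only [φ]
    rw [backward_heat_operator_cutoff_mul a (by linarith [ht.2]) (contDiff_infty.1 hχk 2) (hηd t) x,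
      vlap_comp_smul, fderiv_comp_smul]
    simp [w]
  have hinner {t : ℝ} (ht : t ∈ Ioo 0 T) :
      Tendsto (fun k => ∫ x, v x t * (backwardHeatKernel (T + 1) a x t * w k t x)) atTop
        (nhds (deriv η t * ∫ x, v x t * backwardHeatKernel (T + 1) a x t)) := by
    rw [← integral_const_mul]
    refine tendsto_integral_of_dominated_convergence (fun x => C * t ^ (-γ) * (M * G x))
      (fun k => ((hwmeas k).comp measurable_prodMk_right).aestronglyMeasurable)
      ((hG.const_mul _).const_mul _) (fun k => hbound k ht) (ae_of_all _ fun x => ?_)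
    have hcx : Tendsto (fun k => c k • x) atTop (nhds 0) := by simpa using hclim.smul_const x
    have hχ0 : χ 0 = 1 := χ.one_of_mem_closedBall (mem_closedBall_self χ.rIn_pos.le)
    have l0 := (χ.continuous.tendsto 0).comp hcx
    have l1 := ((hχD.clm_apply continuous_const).tendsto' 0 (fderiv ℝ χ 0 (x - a)) rfl).comp hcx
    have l2 := (hχL.tendsto 0).comp hcx
    have l := ((l0.const_mul (deriv η t)).add ((((hclim.pow 2).mul l2).sub
      ((hclim.mul l1).const_mul (T + 1 - t)⁻¹)).const_mul (η t))).const_mul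
      (backwardHeatKernel (T + 1) a x t) |>.const_mul (v x t)
    simp only [hχ0, ne_eq, OfNat.ofNat_ne_zero, not_false_eq_true, zero_pow, zero_mul, mul_zero,
      sub_zero, add_zero, mul_one] at l
    simpa only [Function.comp_def, mul_comm (deriv η t), mul_assoc, w] using l
  have houter := tendsto_integral_of_dominated_convergence (μ := volume.restrict (Ioo 0 T))
    (fun t => C * t ^ (-γ) * ∫ x, M * G x)
    (fun k => (hwmeas k).stronglyMeasurable.integral_prod_left'.aestronglyMeasurable)
    (((integrableOn_Ioo_rpow_neg hT hγ).const_mul C).mul_const _)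
    (fun k => ?_) ((ae_restrict_mem measurableSet_Ioo).mono fun t ht => hinner ht)
  · simp only [hzero] at houter
    exact tendsto_nhds_unique houter tendsto_const_nhds
  · filter_upwards [ae_restrict_mem measurableSet_Ioo] with t ht
    rw [← integral_const_mul]
    exact norm_integral_le_of_norm_le ((hG.const_mul _).const_mul _) (hbound k ht)

end WeakSolution

/-- **Proposition B.1**: uniqueness for the heat equation on `ℝⁿ` under the weighted
bound `sup_t t^γ ‖v(·,t)‖_∞ < ∞` with `γ < 1`. -/
theorem heat_uniqueness_wholespace
    (n : ℕ) (hn : 1 ≤ n) (T γ : ℝ) (hT : 0 < T) (hγ0 : 0 ≤ γ) (hγ1 : γ < 1)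
    (v : En n → ℝ → ℝ)
    (hmeas : Measurable (fun p : En n × ℝ => v p.1 p.2))
    (hloc : LocallyIntegrableOn (fun p : En n × ℝ => v p.1 p.2)
        ((univ : Set (En n)) ×ˢ Ioo 0 T))
    -- sup_{0<t<T} t^γ ess sup |v(·,t)| < ∞
    (hbd : ∃ C : ℝ, ∀ t ∈ Ioo (0 : ℝ) T,
        ∀ᵐ x ∂(volume : Measure (En n)), t ^ γ * |v x t| ≤ C)
    -- the weak form ∫∫ v (∂ₜφ + Δφ) = 0
    (hweak : ∀ φ : En n × ℝ → ℝ, ContDiff ℝ (⊤ : ℕ∞) φ → HasCompactSupport φ →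
        tsupport φ ⊆ (univ : Set (En n)) ×ˢ Iio T →
        ∫ t in Ioo (0 : ℝ) T, ∫ x : En n,
          v x t * (deriv (fun s => φ (x, s)) t + vlap (fun y => φ (y, t)) x) = 0) :
    ∀ᵐ p : En n × ℝ ∂(volume : Measure (En n × ℝ)),
      p.2 ∈ Ioo (0 : ℝ) T → v p.1 p.2 = 0 := by
  obtain ⟨C, hC⟩ := hbd
  have hzero (a : En n) : ∀ᵐ t : ℝ, t ∈ Ioo 0 T →
      ∫ x, v x t * backwardHeatKernel (T + 1) a x t = 0 := by
    refine isOpen_Ioo.ae_eq_zero_of_integral_contDiff_smul_eq_zero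
      (integrableOn_integral_mul_backwardHeatKernel hT hγ1 hmeas hC a).locallyIntegrableOn
      fun ζ hζ hζc hζs => ?_
    obtain ⟨η, hη, hηc, hηs, hηζ⟩ := exists_contDiff_hasCompactSupport_deriv_eq hT hζ hζc hζs
    rw [← setIntegral_deriv_mul_integral_mul_backwardHeatKernel_eq_zero hT hγ1 hmeas hC hweak a
      hη hηc hηs, ← setIntegral_eq_integral_of_forall_compl_eq_zero (s := Ioo 0 T) fun t ht => ?_]
    · exact setIntegral_congr_fun measurableSet_Ioo fun t ht => by simp [hηζ t ht]
    · rw [image_eq_zero_of_notMem_tsupport fun h => ht (hζs h), zero_smul]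
  obtain ⟨D, hDc, hDd⟩ := TopologicalSpace.exists_countable_dense (En n)
  have hslice : ∀ᵐ t : ℝ, ∀ᵐ x : En n, t ∈ Ioo 0 T → v x t = 0 := by
    filter_upwards [(ae_ball_iff hDc).2 fun a _ => hzero a] with t ht
    by_cases htT : t ∈ Ioo 0 T
    · have hr : 0 < T + 1 - t := by linarith [htT.2]
      have := ae_eq_zero_of_integral_mul_exp_neg_mul_norm_sub_sq_eq_zero
        (hmeas.comp measurable_prodMk_right) (ae_abs_le_mul_rpow_neg hC htT)
        (b := (4 * (T + 1 - t))⁻¹) (by positivity) hDd fun a ha => ?_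
      · exact this.mono fun x hx _ => hx
      · have h := ht a ha htT
        simp only [backwardHeatKernel, sub_eq_add_neg _ (_ * ‖_‖ ^ 2), Real.exp_add,
          mul_left_comm (v _ t), integral_const_mul] at h
        simpa [Real.exp_ne_zero, neg_mul] using h
    · exact ae_of_all _ fun x hx => absurd hx htT
  have hset : MeasurableSet {p : En n × ℝ | p.2 ∈ Ioo 0 T → v p.1 p.2 = 0} :=
    (measurableSet_Ioo.preimage measurable_snd).imp (hmeas (measurableSet_singleton 0))
  rw [Measure.volume_eq_prod, Measure.ae_prod_iff_ae_ae hset]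
  exact (Measure.ae_ae_comm hset).2 hslice
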